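/- Suppose CG < Cp. Let (i,j,k,l) ∈ X_D be a decision state with l < CG. If h1/μ1 ≤ h2/μ2 and 1/μ1 ≤ 1/μ2, then D(i,j,k,l) = v(i,j-1,k+1,l) − v(i,j-1,k,l+1) ≤ 0. -/

import Mathlib

/-- Total service rate `d(j,k,l) = j·μ0 + k·μ1 + min(l,CG)·μ2`. -/
noncomputable def dRate (μ0 μ1 μ2 : ℝ) (CG j k l : ℕ) : ℝ :=
  (j : ℝ) * μ0 + (k : ℝ) * μ1 + ((min l CG : ℕ) : ℝ) * μ2

/-- The value function `v`, defined by well-founded recursion on `2(i+j)+k+l`.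
For nonzero states of the state space it satisfies
`d(j,k,l) · v i j k l = holding costs + transition terms`
(terms with zero coefficient are guarded by `if` and contribute `0`). -/
noncomputable def v (μ0 μ1 μ2 h0 h1 h2 : ℝ) (CG : ℕ) : ℕ → ℕ → ℕ → ℕ → ℝ
  | 0, 0, 0, 0 => 0
  | 0, j, k, l =>
    ((j : ℝ) * h0 + (k : ℝ) * h1 + (l : ℝ) * h2
      + (if _ : 1 ≤ j then
          (j : ℝ) * μ0 *
            min (v μ0 μ1 μ2 h0 h1 h2 CG 0 (j - 1) (k + 1) l)
                (v μ0 μ1 μ2 h0 h1 h2 CG 0 (j - 1) k (l + 1))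
        else 0)
      + (if _ : 1 ≤ k then (k : ℝ) * μ1 * v μ0 μ1 μ2 h0 h1 h2 CG 0 j (k - 1) l else 0)
      + (if _ : 1 ≤ l then
          ((min l CG : ℕ) : ℝ) * μ2 * v μ0 μ1 μ2 h0 h1 h2 CG 0 j k (l - 1)
        else 0))
    / dRate μ0 μ1 μ2 CG j k l
  | i + 1, j, k, l =>
    (((i : ℝ) + 1 + (j : ℝ)) * h0 + (k : ℝ) * h1 + (l : ℝ) * h2
      + (if _ : 1 ≤ j then
          (j : ℝ) * μ0 *
            min (v μ0 μ1 μ2 h0 h1 h2 CG (i + 1) (j - 1) (k + 1) l)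
                (v μ0 μ1 μ2 h0 h1 h2 CG (i + 1) (j - 1) k (l + 1))
        else 0)
      + (if _ : 1 ≤ k then (k : ℝ) * μ1 * v μ0 μ1 μ2 h0 h1 h2 CG i (j + 1) (k - 1) l else 0)
      + (if _ : 1 ≤ l then
          ((min l CG : ℕ) : ℝ) * μ2 * v μ0 μ1 μ2 h0 h1 h2 CG i (j + 1) k (l - 1)
        else 0))
    / dRate μ0 μ1 μ2 CG j k l
termination_by i j k l => 2 * (i + j) + k + l
decreasing_by all_goals omega

/-- Membership in the state space `X`. -/
def memX (Cp : ℕ) (i j k l : ℕ) : Prop :=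
  (i = 0 ∧ j + k + l < Cp) ∨ j + k + l = Cp

/-- Expected waiting cost when class 1 is always chosen. -/
noncomputable def Wt (μ0 μ1 μ2 h0 : ℝ) (CG : ℕ) : ℕ → ℕ → ℕ → ℕ → ℝ
  | 0, _, _, _ => 0
  | i + 1, 0, k, l =>
    (((i : ℝ) + 1) * h0 + (k : ℝ) * μ1 * Wt μ0 μ1 μ2 h0 CG i 1 (k - 1) l
      + ((min l CG : ℕ) : ℝ) * μ2 * Wt μ0 μ1 μ2 h0 CG i 1 k (l - 1)) / dRate μ0 μ1 μ2 CG 0 k l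
  | i + 1, j + 1, k, l =>
    (((i : ℝ) + 1) * h0 + ((j : ℝ) + 1) * μ0 * Wt μ0 μ1 μ2 h0 CG (i + 1) j (k + 1) l
      + (k : ℝ) * μ1 * Wt μ0 μ1 μ2 h0 CG i (j + 2) (k - 1) l
      + ((min l CG : ℕ) : ℝ) * μ2 * Wt μ0 μ1 μ2 h0 CG i (j + 2) k (l - 1))
      / dRate μ0 μ1 μ2 CG (j + 1) k l
termination_by i j _ _ => (i, j)

theorem dRate_pos (μ0 μ1 μ2 : ℝ) (CG : ℕ) (hCG : 0 < CG)
    (hμ0 : 0 < μ0) (hμ1 : 0 < μ1) (hμ2 : 0 < μ2) (j k l : ℕ) (h : 1 ≤ j + k + l) :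
    0 < dRate μ0 μ1 μ2 CG j k l := by
  unfold dRate
  have a : 0 ≤ (j : ℝ) * μ0 := by positivity
  have b : 0 ≤ (k : ℝ) * μ1 := by positivity
  have c : 0 ≤ ((min l CG : ℕ) : ℝ) * μ2 := by positivity
  rcases Nat.eq_zero_or_pos j with hj | hj
  · rcases Nat.eq_zero_or_pos k with hk | hk
    · have : 0 < min l CG := by omega
      have : 0 < ((min l CG : ℕ) : ℝ) * μ2 := by positivity
      linarith
    · have : 0 < (k : ℝ) * μ1 := by positivity
      linarith
  · have : 0 < (j : ℝ) * μ0 := by positivity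
    linarith

theorem Wt_zero (μ0 μ1 μ2 h0 : ℝ) (CG j k l : ℕ) : Wt μ0 μ1 μ2 h0 CG 0 j k l = 0 := by
  rw [Wt]

theorem Wt_rec (μ0 μ1 μ2 h0 : ℝ) (CG : ℕ) (hCG : 0 < CG)
    (hμ0 : 0 < μ0) (hμ1 : 0 < μ1) (hμ2 : 0 < μ2) (i j k l : ℕ) (h : 1 ≤ j + k + l) :
    ((j : ℝ) * μ0 + (k : ℝ) * μ1 + ((min l CG : ℕ) : ℝ) * μ2) * Wt μ0 μ1 μ2 h0 CG (i + 1) j k l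
      = ((i : ℝ) + 1) * h0 + (j : ℝ) * μ0 * Wt μ0 μ1 μ2 h0 CG (i + 1) (j - 1) (k + 1) l
      + (k : ℝ) * μ1 * Wt μ0 μ1 μ2 h0 CG i (j + 1) (k - 1) l
      + ((min l CG : ℕ) : ℝ) * μ2 * Wt μ0 μ1 μ2 h0 CG i (j + 1) k (l - 1) := by
  have hd := dRate_pos μ0 μ1 μ2 CG hCG hμ0 hμ1 hμ2 j k l h
  change dRate μ0 μ1 μ2 CG j k l * _ = _
  cases j with
  | zero =>
    rw [Wt, mul_div_cancel₀ _ hd.ne']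
    simp
  | succ j =>
    rw [Wt, mul_div_cancel₀ _ hd.ne']
    push_cast
    simp

theorem Wt_nonneg (μ0 μ1 μ2 h0 : ℝ) (CG : ℕ)
    (hμ0 : 0 < μ0) (hμ1 : 0 < μ1) (hμ2 : 0 < μ2) (hh0 : 0 < h0) (i : ℕ) :
    ∀ j k l, 0 ≤ Wt μ0 μ1 μ2 h0 CG i j k l := by
  induction i with
  | zero => intro j k l; rw [Wt]
  | succ i ih =>
    intro j
    induction j with
    | zero =>
      intro k l
      have := ih 1 (k - 1) l
      have := ih 1 k (l - 1)
      rw [Wt, dRate]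
      positivity
    | succ j jh =>
      intro k l
      have := jh (k + 1) l
      have := ih (j + 2) (k - 1) l
      have := ih (j + 2) k (l - 1)
      rw [Wt, dRate]
      positivity

theorem Wt_mono (μ0 μ1 μ2 h0 : ℝ) (CG : ℕ) (hCG : 0 < CG)
    (hμ0 : 0 < μ0) (hμ1 : 0 < μ1) (hμ2 : 0 < μ2) (hh0 : 0 < h0) (i : ℕ) :
    ∀ j k l, 1 ≤ j + k + l →
      Wt μ0 μ1 μ2 h0 CG i j k l ≤ Wt μ0 μ1 μ2 h0 CG (i + 1) j k l := by
  induction i with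
  | zero => intro j k l _; rw [Wt_zero]; exact Wt_nonneg _ _ _ _ _ hμ0 hμ1 hμ2 hh0 _ _ _ _
  | succ i ih =>
    intro j
    induction j with
    | zero =>
      intro k l h
      have hd := dRate_pos μ0 μ1 μ2 CG hCG hμ0 hμ1 hμ2 0 k l h
      have e1 := Wt_rec μ0 μ1 μ2 h0 CG hCG hμ0 hμ1 hμ2 i 0 k l h
      have e2 := Wt_rec μ0 μ1 μ2 h0 CG hCG hμ0 hμ1 hμ2 (i + 1) 0 k l h
      refine le_of_mul_le_mul_left ?_ hd
      unfold dRate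
      rw [e1, e2]
      have a := ih 1 (k - 1) l (by omega)
      have b := ih 1 k (l - 1) (by omega)
      push_cast
      simp only [zero_mul, zero_add]
      gcongr
      linarith
    | succ j jh =>
      intro k l h
      have hd := dRate_pos μ0 μ1 μ2 CG hCG hμ0 hμ1 hμ2 (j + 1) k l h
      have e1 := Wt_rec μ0 μ1 μ2 h0 CG hCG hμ0 hμ1 hμ2 i (j + 1) k l h
      have e2 := Wt_rec μ0 μ1 μ2 h0 CG hCG hμ0 hμ1 hμ2 (i + 1) (j + 1) k l h
      refine le_of_mul_le_mul_left ?_ hd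
      unfold dRate
      rw [e1, e2]
      have a := ih (j + 1 + 1) (k - 1) l (by omega)
      have b := ih (j + 1 + 1) k (l - 1) (by omega)
      have c := jh (k + 1) l (by omega)
      simp only [Nat.add_sub_cancel]
      push_cast
      gcongr
      linarith

/-- Step for "a departure helps". -/
theorem Wt_stepF (μ0 μ1 μ2 h0 : ℝ) (CG : ℕ) (hCG : 0 < CG)
    (hμ0 : 0 < μ0) (hμ1 : 0 < μ1) (hμ2 : 0 < μ2) (hh0 : 0 < h0) (i j : ℕ)
    (ihE : ∀ j k l, Wt μ0 μ1 μ2 h0 CG i j (k + 1) l ≤ Wt μ0 μ1 μ2 h0 CG i j k (l + 1))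
    (ihF : 0 < i → ∀ j k l, Wt μ0 μ1 μ2 h0 CG (i - 1) (j + 1) k l ≤ Wt μ0 μ1 μ2 h0 CG i j k (l + 1))
    (jhF : 0 < j → ∀ k l, Wt μ0 μ1 μ2 h0 CG i (j - 1 + 1) k l
      ≤ Wt μ0 μ1 μ2 h0 CG (i + 1) (j - 1) k (l + 1)) (k l : ℕ) :
    Wt μ0 μ1 μ2 h0 CG i (j + 1) k l ≤ Wt μ0 μ1 μ2 h0 CG (i + 1) j k (l + 1) := by
  cases i with
  | zero => rw [Wt_zero]; exact Wt_nonneg _ _ _ _ _ hμ0 hμ1 hμ2 hh0 _ _ _ _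
  | succ i =>
    have ez := Wt_rec μ0 μ1 μ2 h0 CG hCG hμ0 hμ1 hμ2 i (j + 1) k l (by omega)
    have ey := Wt_rec μ0 μ1 μ2 h0 CG hCG hμ0 hμ1 hμ2 (i + 1) j k (l + 1) (by omega)
    have hH := (ihE j k l).trans (Wt_mono μ0 μ1 μ2 h0 CG hCG hμ0 hμ1 hμ2 hh0 (i + 1) j k (l + 1)
      (by omega))
    have hd : 0 < dRate μ0 μ1 μ2 CG (j + 1) k (l + 1) :=
      dRate_pos μ0 μ1 μ2 CG hCG hμ0 hμ1 hμ2 _ _ _ (by omega)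
    obtain ⟨δ, hδ, hδ0⟩ : ∃ δ : ℝ, ((min (l + 1) CG : ℕ) : ℝ) = ((min l CG : ℕ) : ℝ) + δ ∧ 0 ≤ δ := by
      refine ⟨((min (l + 1) CG : ℕ) : ℝ) - ((min l CG : ℕ) : ℝ), by ring, ?_⟩
      have : min l CG ≤ min (l + 1) CG := by omega
      have : ((min l CG : ℕ) : ℝ) ≤ ((min (l + 1) CG : ℕ) : ℝ) := by exact_mod_cast this
      linarith
    have hm : (0 : ℝ) ≤ ((min l CG : ℕ) : ℝ) := by positivity
    have tj : (j : ℝ) * μ0 * Wt μ0 μ1 μ2 h0 CG (i + 1) j (k + 1) l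
        ≤ (j : ℝ) * μ0 * Wt μ0 μ1 μ2 h0 CG (i + 1 + 1) (j - 1) (k + 1) (l + 1) := by
      rcases Nat.eq_zero_or_pos j with hj | hj
      · simp [hj]
      · have := jhF hj (k + 1) l
        rw [Nat.sub_add_cancel hj] at this
        gcongr
    have tk : (k : ℝ) * μ1 * Wt μ0 μ1 μ2 h0 CG i (j + 1 + 1) (k - 1) l
        ≤ (k : ℝ) * μ1 * Wt μ0 μ1 μ2 h0 CG (i + 1) (j + 1) (k - 1) (l + 1) := by
      have := ihF (by omega) (j + 1) (k - 1) l
      simp only [Nat.add_sub_cancel] at this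
      gcongr
    have tl : ((min l CG : ℕ) : ℝ) * μ2 * Wt μ0 μ1 μ2 h0 CG i (j + 1 + 1) k (l - 1)
        ≤ ((min l CG : ℕ) : ℝ) * μ2 * Wt μ0 μ1 μ2 h0 CG (i + 1) (j + 1) k l := by
      rcases Nat.eq_zero_or_pos l with hl | hl
      · simp [hl]
      · have := ihF (by omega) (j + 1) k (l - 1)
        rw [Nat.sub_add_cancel hl] at this
        simp only [Nat.add_sub_cancel] at this
        gcongr
    have t0 := mul_le_mul_of_nonneg_left hH hμ0.le
    refine le_of_mul_le_mul_left ?_ hd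
    unfold dRate
    rw [hδ] at ey ⊢
    simp only [Nat.add_sub_cancel] at ez ey
    simp only [Nat.cast_add, Nat.cast_one] at ez ey ⊢
    linarith

/-- Step for "class 1 is better than class 2". -/
theorem Wt_stepE (μ0 μ1 μ2 h0 : ℝ) (CG : ℕ) (hCG : 0 < CG)
    (hμ0 : 0 < μ0) (hμ1 : 0 < μ1) (hμ2 : 0 < μ2) (h12 : μ2 ≤ μ1) (i j : ℕ)
    (ihE : ∀ j k l, Wt μ0 μ1 μ2 h0 CG i j (k + 1) l ≤ Wt μ0 μ1 μ2 h0 CG i j k (l + 1))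
    (F : ∀ k l, Wt μ0 μ1 μ2 h0 CG i (j + 1) k l ≤ Wt μ0 μ1 μ2 h0 CG (i + 1) j k (l + 1))
    (jhE : 0 < j → ∀ k l, Wt μ0 μ1 μ2 h0 CG (i + 1) (j - 1) (k + 1) l
      ≤ Wt μ0 μ1 μ2 h0 CG (i + 1) (j - 1) k (l + 1)) (k l : ℕ) :
    Wt μ0 μ1 μ2 h0 CG (i + 1) j (k + 1) l ≤ Wt μ0 μ1 μ2 h0 CG (i + 1) j k (l + 1) := by
  have ex := Wt_rec μ0 μ1 μ2 h0 CG hCG hμ0 hμ1 hμ2 i j (k + 1) l (by omega)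
  have ey := Wt_rec μ0 μ1 μ2 h0 CG hCG hμ0 hμ1 hμ2 i j k (l + 1) (by omega)
  have hd : 0 < dRate μ0 μ1 μ2 CG j (k + 1) l :=
    dRate_pos μ0 μ1 μ2 CG hCG hμ0 hμ1 hμ2 _ _ _ (by omega)
  obtain ⟨δ, hδ, hδ1⟩ : ∃ δ : ℝ, ((min (l + 1) CG : ℕ) : ℝ) = ((min l CG : ℕ) : ℝ) + δ ∧ δ ≤ 1 := by
    refine ⟨((min (l + 1) CG : ℕ) : ℝ) - ((min l CG : ℕ) : ℝ), by ring, ?_⟩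
    have : min (l + 1) CG ≤ min l CG + 1 := by omega
    have : ((min (l + 1) CG : ℕ) : ℝ) ≤ ((min l CG : ℕ) : ℝ) + 1 := by exact_mod_cast this
    linarith
  have tj : (j : ℝ) * μ0 * Wt μ0 μ1 μ2 h0 CG (i + 1) (j - 1) (k + 1 + 1) l
      ≤ (j : ℝ) * μ0 * Wt μ0 μ1 μ2 h0 CG (i + 1) (j - 1) (k + 1) (l + 1) := by
    rcases Nat.eq_zero_or_pos j with hj | hj
    · simp [hj]
    · have := jhE hj (k + 1) l
      gcongr
  have tk : (k : ℝ) * μ1 * Wt μ0 μ1 μ2 h0 CG i (j + 1) k l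
      ≤ (k : ℝ) * μ1 * Wt μ0 μ1 μ2 h0 CG i (j + 1) (k - 1) (l + 1) := by
    rcases Nat.eq_zero_or_pos k with hk | hk
    · simp [hk]
    · have := ihE (j + 1) (k - 1) l
      rw [Nat.sub_add_cancel hk] at this
      gcongr
  have tl : ((min l CG : ℕ) : ℝ) * μ2 * Wt μ0 μ1 μ2 h0 CG i (j + 1) (k + 1) (l - 1)
      ≤ ((min l CG : ℕ) : ℝ) * μ2 * Wt μ0 μ1 μ2 h0 CG i (j + 1) k l := by
    rcases Nat.eq_zero_or_pos l with hl | hl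
    · simp [hl]
    · have := ihE (j + 1) k (l - 1)
      rw [Nat.sub_add_cancel hl] at this
      gcongr
  have hc : 0 ≤ μ1 - δ * μ2 := by nlinarith
  have t0 := mul_le_mul_of_nonneg_left (F k l) hc
  refine le_of_mul_le_mul_left ?_ hd
  unfold dRate
  rw [hδ] at ey
  simp only [Nat.add_sub_cancel] at ex ey
  simp only [Nat.cast_add, Nat.cast_one] at ex ey ⊢
  linarith

theorem Wt_EF (μ0 μ1 μ2 h0 : ℝ) (CG : ℕ) (hCG : 0 < CG)
    (hμ0 : 0 < μ0) (hμ1 : 0 < μ1) (hμ2 : 0 < μ2) (hh0 : 0 < h0) (h12 : μ2 ≤ μ1) (i : ℕ) :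
    (∀ j k l, Wt μ0 μ1 μ2 h0 CG i j (k + 1) l ≤ Wt μ0 μ1 μ2 h0 CG i j k (l + 1)) ∧
    (0 < i → ∀ j k l,
      Wt μ0 μ1 μ2 h0 CG (i - 1) (j + 1) k l ≤ Wt μ0 μ1 μ2 h0 CG i j k (l + 1)) := by
  induction i with
  | zero => exact ⟨fun j k l => by rw [Wt_zero, Wt_zero], fun h => absurd h (by omega)⟩
  | succ i ih =>
    have key : ∀ j, (∀ k l, Wt μ0 μ1 μ2 h0 CG (i + 1) j (k + 1) l
        ≤ Wt μ0 μ1 μ2 h0 CG (i + 1) j k (l + 1)) ∧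
        (∀ k l, Wt μ0 μ1 μ2 h0 CG i (j + 1) k l ≤ Wt μ0 μ1 μ2 h0 CG (i + 1) j k (l + 1)) := by
      intro j
      induction j with
      | zero =>
        have F := Wt_stepF μ0 μ1 μ2 h0 CG hCG hμ0 hμ1 hμ2 hh0 i 0 ih.1 ih.2
          (fun h => absurd h (by omega))
        exact ⟨Wt_stepE μ0 μ1 μ2 h0 CG hCG hμ0 hμ1 hμ2 h12 i 0 ih.1 F
          (fun h => absurd h (by omega)), F⟩
      | succ j jh =>
        have F := Wt_stepF μ0 μ1 μ2 h0 CG hCG hμ0 hμ1 hμ2 hh0 i (j + 1) ih.1 ih.2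
          (fun _ => jh.2)
        exact ⟨Wt_stepE μ0 μ1 μ2 h0 CG hCG hμ0 hμ1 hμ2 h12 i (j + 1) ih.1 F
          (fun _ => jh.1), F⟩
    exact ⟨fun j => (key j).1, fun _ j => (key j).2⟩

/-- Total expected cost of the class 2 customers. -/
noncomputable def gc (μ2 h2 : ℝ) (CG : ℕ) : ℕ → ℝ
  | 0 => 0
  | l + 1 => gc μ2 h2 CG l + ((l : ℝ) + 1) * h2 / (((min (l + 1) CG : ℕ) : ℝ) * μ2)

theorem gc_rec (μ2 h2 : ℝ) (CG : ℕ) (hCG : 0 < CG) (hμ2 : 0 < μ2) (l : ℕ) :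
    ((min l CG : ℕ) : ℝ) * μ2 * gc μ2 h2 CG l
      = (l : ℝ) * h2 + ((min l CG : ℕ) : ℝ) * μ2 * gc μ2 h2 CG (l - 1) := by
  cases l with
  | zero => simp
  | succ l =>
    have h : 0 < min (l + 1) CG := by omega
    have : (0 : ℝ) < ((min (l + 1) CG : ℕ) : ℝ) * μ2 := by positivity
    rw [gc, mul_add, mul_div_cancel₀ _ this.ne']
    simp only [Nat.add_sub_cancel]
    push_cast
    ring

theorem gc_succ (μ2 h2 : ℝ) (CG : ℕ) (hCG : 0 < CG) (hμ2 : 0 < μ2) (hh2 : 0 < h2) (l : ℕ) :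
    gc μ2 h2 CG l + h2 / μ2 ≤ gc μ2 h2 CG (l + 1) := by
  rw [gc]
  have h : 0 < min (l + 1) CG := by omega
  have h' : (0 : ℝ) < ((min (l + 1) CG : ℕ) : ℝ) := by exact_mod_cast h
  have h3 : ((min (l + 1) CG : ℕ) : ℝ) ≤ (l : ℝ) + 1 := by
    exact_mod_cast (by omega : min (l + 1) CG ≤ l + 1)
  have : h2 / μ2 ≤ ((l : ℝ) + 1) * h2 / (((min (l + 1) CG : ℕ) : ℝ) * μ2) := by
    rw [div_le_div_iff₀ hμ2 (by positivity)]
    nlinarith [mul_pos hh2 hμ2]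
  linarith

/-- Closed form of the value function. -/
noncomputable def Vc (μ0 μ1 μ2 h0 h1 h2 : ℝ) (CG i j k l : ℕ) : ℝ :=
  ((i : ℝ) + (j : ℝ)) * (h0 / μ0 + h1 / μ1) + (k : ℝ) * (h1 / μ1) + gc μ2 h2 CG l
    + Wt μ0 μ1 μ2 h0 CG i j k l

theorem Vc_le (μ0 μ1 μ2 h0 h1 h2 : ℝ) (CG : ℕ) (hCG : 0 < CG)
    (hμ0 : 0 < μ0) (hμ1 : 0 < μ1) (hμ2 : 0 < μ2) (hh0 : 0 < h0) (hh2 : 0 < h2)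
    (h12 : μ2 ≤ μ1) (hh : h1 / μ1 ≤ h2 / μ2) (i j k l : ℕ) :
    Vc μ0 μ1 μ2 h0 h1 h2 CG i j (k + 1) l ≤ Vc μ0 μ1 μ2 h0 h1 h2 CG i j k (l + 1) := by
  have a := (Wt_EF μ0 μ1 μ2 h0 CG hCG hμ0 hμ1 hμ2 hh0 h12 i).1 j k l
  have b := gc_succ μ2 h2 CG hCG hμ2 hh2 l
  unfold Vc
  push_cast
  linarith

theorem v_eq_Vc (μ0 μ1 μ2 h0 h1 h2 : ℝ) (CG : ℕ) (hCG : 0 < CG)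
    (hμ0 : 0 < μ0) (hμ1 : 0 < μ1) (hμ2 : 0 < μ2) (hh0 : 0 < h0) (hh2 : 0 < h2)
    (h12 : μ2 ≤ μ1) (hh : h1 / μ1 ≤ h2 / μ2) (n : ℕ) :
    ∀ i j k l : ℕ, 2 * (i + j) + k + l = n → (i = 0 ∨ 1 ≤ j + k + l) →
      v μ0 μ1 μ2 h0 h1 h2 CG i j k l = Vc μ0 μ1 μ2 h0 h1 h2 CG i j k l := by
  induction n using Nat.strong_induction_on with
  | _ n ih =>
    intro i j k l hn hs
    have hmin := Vc_le μ0 μ1 μ2 h0 h1 h2 CG hCG hμ0 hμ1 hμ2 hh0 hh2 h12 hh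
    have hg := gc_rec μ2 h2 CG hCG hμ2 l
    have q0 : μ0 * (h0 / μ0) = h0 := mul_div_cancel₀ _ hμ0.ne'
    have q1 : μ1 * (h1 / μ1) = h1 := mul_div_cancel₀ _ hμ1.ne'
    by_cases h0s : i = 0 ∧ j + k + l = 0
    · obtain ⟨rfl, h⟩ := h0s
      obtain ⟨rfl, rfl, rfl⟩ : j = 0 ∧ k = 0 ∧ l = 0 := by omega
      simp [v, Vc, gc, Wt_zero]
    have hs' : 1 ≤ j + k + l := by omega
    have hd := dRate_pos μ0 μ1 μ2 CG hCG hμ0 hμ1 hμ2 j k l hs'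
    cases i with
    | zero =>
      have tj : (if _ : 1 ≤ j then (j : ℝ) * μ0 *
            min (v μ0 μ1 μ2 h0 h1 h2 CG 0 (j - 1) (k + 1) l)
                (v μ0 μ1 μ2 h0 h1 h2 CG 0 (j - 1) k (l + 1)) else 0)
          = (j : ℝ) * μ0 * (Vc μ0 μ1 μ2 h0 h1 h2 CG 0 j k l - h0 / μ0) := by
        split_ifs with hj
        · rw [ih _ (by omega) 0 (j - 1) (k + 1) l rfl (by omega),
            ih _ (by omega) 0 (j - 1) k (l + 1) rfl (by omega), min_eq_left (hmin _ _ _ _)]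
          simp only [Vc, Wt_zero]
          push_cast [Nat.cast_sub hj]
          ring
        · have : j = 0 := by omega
          simp [this]
      have tk : (if _ : 1 ≤ k then (k : ℝ) * μ1 * v μ0 μ1 μ2 h0 h1 h2 CG 0 j (k - 1) l else 0)
          = (k : ℝ) * μ1 * (Vc μ0 μ1 μ2 h0 h1 h2 CG 0 j k l - h1 / μ1) := by
        split_ifs with hk
        · rw [ih _ (by omega) 0 j (k - 1) l rfl (by omega)]
          simp only [Vc, Wt_zero]
          push_cast [Nat.cast_sub hk]
          ring
        · have : k = 0 := by omega
          simp [this]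
      have tl : (if _ : 1 ≤ l then ((min l CG : ℕ) : ℝ) * μ2 * v μ0 μ1 μ2 h0 h1 h2 CG 0 j k (l - 1)
            else 0)
          = ((min l CG : ℕ) : ℝ) * μ2 * Vc μ0 μ1 μ2 h0 h1 h2 CG 0 j k l - l * h2 := by
        split_ifs with hl
        · rw [ih _ (by omega) 0 j k (l - 1) rfl (by omega)]
          simp only [Vc, Wt_zero]
          linarith
        · have : l = 0 := by omega
          simp [this]
      rw [v, tj, tk, tl, div_eq_iff hd.ne']
      · unfold dRate
        linear_combination (-(j : ℝ)) * q0 - (k : ℝ) * q1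
      · omega
    | succ i =>
      have hW := Wt_rec μ0 μ1 μ2 h0 CG hCG hμ0 hμ1 hμ2 i j k l hs'
      have tj : (if _ : 1 ≤ j then (j : ℝ) * μ0 *
            min (v μ0 μ1 μ2 h0 h1 h2 CG (i + 1) (j - 1) (k + 1) l)
                (v μ0 μ1 μ2 h0 h1 h2 CG (i + 1) (j - 1) k (l + 1)) else 0)
          = (j : ℝ) * μ0 * (Vc μ0 μ1 μ2 h0 h1 h2 CG (i + 1) j k l - h0 / μ0
            - Wt μ0 μ1 μ2 h0 CG (i + 1) j k l
            + Wt μ0 μ1 μ2 h0 CG (i + 1) (j - 1) (k + 1) l) := by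
        split_ifs with hj
        · rw [ih _ (by omega) (i + 1) (j - 1) (k + 1) l rfl (by omega),
            ih _ (by omega) (i + 1) (j - 1) k (l + 1) rfl (by omega), min_eq_left (hmin _ _ _ _)]
          simp only [Vc]
          push_cast [Nat.cast_sub hj]
          ring
        · have : j = 0 := by omega
          simp [this]
      have tk : (if _ : 1 ≤ k then (k : ℝ) * μ1 * v μ0 μ1 μ2 h0 h1 h2 CG i (j + 1) (k - 1) l
            else 0)
          = (k : ℝ) * μ1 * (Vc μ0 μ1 μ2 h0 h1 h2 CG (i + 1) j k l - h1 / μ1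
            - Wt μ0 μ1 μ2 h0 CG (i + 1) j k l
            + Wt μ0 μ1 μ2 h0 CG i (j + 1) (k - 1) l) := by
        split_ifs with hk
        · rw [ih _ (by omega) i (j + 1) (k - 1) l rfl (by omega)]
          simp only [Vc]
          push_cast [Nat.cast_sub hk]
          ring
        · have : k = 0 := by omega
          simp [this]
      have tl : (if _ : 1 ≤ l then
            ((min l CG : ℕ) : ℝ) * μ2 * v μ0 μ1 μ2 h0 h1 h2 CG i (j + 1) k (l - 1) else 0)
          = ((min l CG : ℕ) : ℝ) * μ2 * (Vc μ0 μ1 μ2 h0 h1 h2 CG (i + 1) j k l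
            - Wt μ0 μ1 μ2 h0 CG (i + 1) j k l
            + Wt μ0 μ1 μ2 h0 CG i (j + 1) k (l - 1)) - l * h2 := by
        split_ifs with hl
        · rw [ih _ (by omega) i (j + 1) k (l - 1) rfl (by omega)]
          simp only [Vc]
          simp only [Nat.cast_add, Nat.cast_one]
          linarith
        · have : l = 0 := by omega
          simp [this]
      rw [v, tj, tk, tl, div_eq_iff hd.ne']
      unfold dRate
      linear_combination (-(j : ℝ)) * q0 - (k : ℝ) * q1 - hW

theorem stmt4 (Cp CG : ℕ) (μ0 μ1 μ2 h0 h1 h2 : ℝ)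
    (hCp : 0 < Cp) (hCG : 0 < CG) (hCpCG : CG < Cp)
    (hμ0 : 0 < μ0) (hμ1 : 0 < μ1) (hμ2 : 0 < μ2)
    (hh0 : 0 < h0) (hh1 : 0 < h1) (hh2 : 0 < h2)
    : ∀ i j k l : ℕ, memX Cp i j k l → 1 ≤ j → l < CG →
      h1 / μ1 ≤ h2 / μ2 →
      1 / μ1 ≤ 1 / μ2 →
      v μ0 μ1 μ2 h0 h1 h2 CG i (j - 1) (k + 1) l - v μ0 μ1 μ2 h0 h1 h2 CG i (j - 1) k (l + 1) ≤ 0 := by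

  intro i j k l _ hj _ hh hm
  have h12 : μ2 ≤ μ1 := (one_div_le_one_div hμ1 hμ2).mp hm
  have e := v_eq_Vc μ0 μ1 μ2 h0 h1 h2 CG hCG hμ0 hμ1 hμ2 hh0 hh2 h12 hh
  rw [e _ i (j - 1) (k + 1) l rfl (by omega), e _ i (j - 1) k (l + 1) rfl (by omega)]
  exact sub_nonpos.mpr
    (Vc_le μ0 μ1 μ2 h0 h1 h2 CG hCG hμ0 hμ1 hμ2 hh0 hh2 h12 hh i (j - 1) k l)
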